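/- arXiv:1411.3053 — 2 statements merged into one kernel-verified Lean document; each statement's English description precedes it below -/
import Mathlib

section
/- Let V1 and V2 be finite-dimensional real vector spaces, let F1 be a Minkowski norm on V1, and let π : V1 → V2 be a surjective linear map. Then there exists a unique Minkowski norm F2 on V2 such that π maps the unit ball {v ∈ V1 | F1(v) ≤ 1} onto the unit ball {w ∈ V2 | F2(w) ≤ 1} (i.e., such that π is an isometric submersion). -/
/-- A Minkowski norm on a finite-dimensional real vector space. -/
structure IsMinkowskiNorm {V : Type*} [NormedAddCommGroup V] [NormedSpace ℝ V]
    (F : V → ℝ) : Prop where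
  continuous : Continuous F
  map_zero : F 0 = 0
  pos : ∀ y : V, y ≠ 0 → 0 < F y
  pos_homog : ∀ c : ℝ, 0 < c → ∀ y : V, F (c • y) = c * F y
  smooth : ContDiffOn ℝ (⊤ : ℕ∞) F {y | y ≠ 0}
  posdef : ∀ y : V, y ≠ 0 → ∀ u : V, u ≠ 0 →
    0 < (1 / 2 : ℝ) * iteratedFDeriv ℝ 2 (fun x => F x ^ 2) y ![u, u]

open Filter Topology

section helpers

variable {V W : Type*} [NormedAddCommGroup V] [NormedSpace ℝ V]
  [NormedAddCommGroup W] [NormedSpace ℝ W]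

theorem IsMinkowskiNorm.nonneg {F : V → ℝ} (h : IsMinkowskiNorm F) (y : V) : 0 ≤ F y := by
  by_cases hy : y = 0
  · rw [hy, h.map_zero]
  · exact (h.pos y hy).le

theorem IsMinkowskiNorm.contDiffAt {F : V → ℝ} (h : IsMinkowskiNorm F) {y : V} (hy : y ≠ 0) :
    ContDiffAt ℝ (⊤ : ℕ∞) F y :=
  h.smooth.contDiffAt (isOpen_ne.mem_nhds hy)

theorem IsMinkowskiNorm.contDiffAt_sq {F : V → ℝ} (h : IsMinkowskiNorm F) {y : V} (hy : y ≠ 0) :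
    ContDiffAt ℝ (⊤ : ℕ∞) (fun x => F x ^ 2) y :=
  (h.contDiffAt hy).pow 2

theorem IsMinkowskiNorm.hess_pos {F : V → ℝ} (h : IsMinkowskiNorm F) {y : V} (hy : y ≠ 0)
    {u : V} (hu : u ≠ 0) : 0 < fderiv ℝ (fderiv ℝ (fun x => F x ^ 2)) y u u := by
  have := h.posdef y hy u hu
  rw [iteratedFDeriv_two_apply] at this
  simp at this
  exact this

theorem IsMinkowskiNorm.exists_bound [FiniteDimensional ℝ V] {F : V → ℝ}
    (h : IsMinkowskiNorm F) : ∃ c : ℝ, 0 < c ∧ ∀ v, c * ‖v‖ ≤ F v := by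
  have hp : ProperSpace V := FiniteDimensional.proper ℝ V
  by_cases hne : (Metric.sphere (0 : V) 1).Nonempty
  · obtain ⟨x, hx, hmin⟩ := (isCompact_sphere (0 : V) 1).exists_isMinOn hne h.continuous.continuousOn
    have hx1 : ‖x‖ = 1 := by simpa using hx
    have hx0 : x ≠ 0 := by
      rintro rfl
      simp at hx1
    refine ⟨F x, h.pos x hx0, fun v => ?_⟩
    by_cases hv : v = 0
    · simp [hv, h.map_zero]
    · have hn : 0 < ‖v‖ := norm_pos_iff.2 hv
      have h1 : F x ≤ F (‖v‖⁻¹ • v) := hmin (by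
        simp [norm_smul, hn.ne'])
      rw [h.pos_homog _ (inv_pos.2 hn)] at h1
      rw [inv_mul_eq_div, le_div_iff₀ hn] at h1
      exact h1
  · refine ⟨1, one_pos, fun v => ?_⟩
    by_cases hv : v = 0
    · simp [hv, h.map_zero]
    · exact absurd ⟨‖v‖⁻¹ • v, by simp [norm_smul, hv]⟩ hne

theorem IsMinkowskiNorm.exists_min [FiniteDimensional ℝ V] [FiniteDimensional ℝ W] {F : V → ℝ}
    (h : IsMinkowskiNorm F) (P : V →L[ℝ] W) (hP : Function.Surjective P) (w : W) :
    ∃ v, P v = w ∧ ∀ v', P v' = w → F v ≤ F v' := by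
  have hp : ProperSpace V := FiniteDimensional.proper ℝ V
  obtain ⟨c, hc, hb⟩ := h.exists_bound
  have ht : Tendsto F (cocompact V) atTop :=
    tendsto_atTop_mono hb (tendsto_norm_cocompact_atTop.const_mul_atTop hc)
  obtain ⟨v0, hv0⟩ := hP w
  have hcl : IsClosed {v | P v = w} := isClosed_eq P.continuous continuous_const
  obtain ⟨v, hv, hm⟩ := h.continuous.continuousOn.exists_isMinOn' hcl (x₀ := v0) hv0
    ((ht.eventually_ge_atTop (F v0)).filter_mono inf_le_left)
  exact ⟨v, hv, fun v' hv' => hm hv'⟩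

/-- A critical point of `F ^ 2` on a fibre avoiding `0` is a minimum. -/
theorem IsMinkowskiNorm.min_of_crit {F : V → ℝ} (h : IsMinkowskiNorm F) (P : V →L[ℝ] W)
    {v v' : V} (hv : P v ≠ 0) (hv' : P v' = P v)
    (hcrit : ∀ k, P k = 0 → fderiv ℝ (fun x => F x ^ 2) v k = 0) : F v ≤ F v' := by
  set Q : V → ℝ := fun x => F x ^ 2 with hQ
  by_cases hk : v' = v
  · rw [hk]
  set k := v' - v with hkdef
  have hk0 : k ≠ 0 := sub_ne_zero.2 hk
  have hPk : P k = 0 := by simp [hkdef, hv']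
  have hne : ∀ t : ℝ, v + t • k ≠ 0 := by
    intro t h0
    apply hv
    have := congrArg P h0
    simpa [hPk] using this
  have hline : ∀ t : ℝ, HasDerivAt (fun t : ℝ => v + t • k) k t := by
    intro t
    simpa using ((hasDerivAt_id t).smul_const k).const_add v
  have hd1 : ∀ t : ℝ, HasDerivAt (fun t : ℝ => Q (v + t • k)) (fderiv ℝ Q (v + t • k) k) t := by
    intro t
    have := ((h.contDiffAt_sq (hne t)).differentiableAt (by simp)).hasFDerivAt
    exact this.comp_hasDerivAt t (hline t)
  have hd2 : ∀ t : ℝ, HasDerivAt (fun t : ℝ => fderiv ℝ Q (v + t • k) k)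
      (fderiv ℝ (fderiv ℝ Q) (v + t • k) k k) t := by
    intro t
    have h2 : ContDiffAt ℝ 1 (fderiv ℝ Q) (v + t • k) :=
      (h.contDiffAt_sq (hne t)).fderiv_right (by
        rw [one_add_one_eq_two]; exact WithTop.coe_le_coe.2 le_top)
    have h3 := (h2.differentiableAt (by simp)).hasFDerivAt
    have h4 : HasDerivAt (fun t : ℝ => fderiv ℝ Q (v + t • k))
        (fderiv ℝ (fderiv ℝ Q) (v + t • k) k) t := h3.comp_hasDerivAt t (hline t)
    have h5 := h4.clm_apply (hasDerivAt_const t k)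
    simp only [_root_.map_zero, add_zero] at h5
    exact h5
  have hmono : StrictMono (fun t : ℝ => fderiv ℝ Q (v + t • k) k) :=
    strictMono_of_deriv_pos fun t => by
      rw [(hd2 t).deriv]
      exact h.hess_pos (hne t) hk0
  have hm : MonotoneOn (fun t : ℝ => Q (v + t • k)) (Set.Icc 0 1) := by
    apply monotoneOn_of_deriv_nonneg (convex_Icc 0 1)
    · exact fun t _ => (hd1 t).continuousAt.continuousWithinAt
    · exact fun t _ => (hd1 t).differentiableAt.differentiableWithinAt
    · intro t ht
      rw [interior_Icc] at ht
      rw [(hd1 t).deriv]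
      have := hmono.monotone ht.1.le
      simpa [hcrit k hPk] using this
  have h01 := hm (by simp) (by simp) (zero_le_one' ℝ)
  have h01' : F v ^ 2 ≤ F v' ^ 2 := by simpa [hQ, hkdef] using h01
  exact (sq_le_sq₀ (h.nonneg _) (h.nonneg _)).1 h01'

/-- A minimum on a fibre is critical. -/
theorem IsMinkowskiNorm.crit_of_min {F : V → ℝ} (h : IsMinkowskiNorm F) (P : V →L[ℝ] W)
    {v : V} (hv : v ≠ 0) (hmin : ∀ v', P v' = P v → F v ≤ F v') {k : V} (hk : P k = 0) :
    fderiv ℝ (fun x => F x ^ 2) v k = 0 := by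
  have hline : HasDerivAt (fun t : ℝ => v + t • k) k 0 := by
    simpa using ((hasDerivAt_id (0 : ℝ)).smul_const k).const_add v
  have hd := ((h.contDiffAt_sq hv).differentiableAt (by simp)).hasFDerivAt
  have hd1 : HasDerivAt (fun t : ℝ => F (v + t • k) ^ 2)
      (fderiv ℝ (fun x => F x ^ 2) v k) 0 := by
    have hd' : HasFDerivAt (fun x => F x ^ 2) (fderiv ℝ (fun x => F x ^ 2) v)
      (v + (0 : ℝ) • k) := by simpa using hd
    exact hd'.comp_hasDerivAt (0 : ℝ) hline
  have hloc : IsLocalMin (fun t : ℝ => F (v + t • k) ^ 2) 0 := by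
    apply Eventually.of_forall
    intro t
    have := hmin (v + t • k) (by simp [hk])
    have h0 := h.nonneg v
    simp only [zero_smul, add_zero]
    gcongr
  exact hloc.hasDerivAt_eq_zero hd1

/-- Local smooth section of critical points. -/
theorem IsMinkowskiNorm.exists_section_aux {K : Type*} [NormedAddCommGroup K] [NormedSpace ℝ K]
    [FiniteDimensional ℝ K] [FiniteDimensional ℝ V] [FiniteDimensional ℝ W] {F : V → ℝ}
    (h : IsMinkowskiNorm F) (P : V →L[ℝ] W) (j : K →L[ℝ] V)
    (hj : ∀ k, P k = 0 → ∃ x, j x = k) (hPj : ∀ x, P (j x) = 0)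
    (hdim0 : Module.finrank ℝ V = Module.finrank ℝ W + Module.finrank ℝ K)
    {v : V} (hv : v ≠ 0) (hcrit : ∀ k, P k = 0 → fderiv ℝ (fun x => F x ^ 2) v k = 0) :
    ∃ g : W → V, g (P v) = v ∧ ContDiffAt ℝ (⊤ : ℕ∞) g (P v) ∧
      ∀ᶠ w in 𝓝 (P v), P (g w) = w ∧ ∀ k, P k = 0 → fderiv ℝ (fun x => F x ^ 2) (g w) k = 0 := by
  have hcV : CompleteSpace V := FiniteDimensional.complete ℝ V
  set Q : V → ℝ := fun x => F x ^ 2 with hQ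
  let R : (V →L[ℝ] ℝ) →L[ℝ] (K →L[ℝ] ℝ) := (ContinuousLinearMap.compL ℝ K V ℝ).flip j
  have hR : ∀ (l : V →L[ℝ] ℝ) (k : K), R l k = l (j k) := fun l k => rfl
  let Ψ : V → W × (K →L[ℝ] ℝ) := fun x => (P x, R (fderiv ℝ Q x))
  have hQ2 : ContDiffAt ℝ (⊤ : ℕ∞) (fderiv ℝ Q) v :=
    (h.contDiffAt_sq hv).fderiv_right (by rfl)
  have hRQ : ContDiffAt ℝ (⊤ : ℕ∞) (fun x => R (fderiv ℝ Q x)) v :=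
    hQ2.continuousLinearMap_comp R
  have hΨ : ContDiffAt ℝ (⊤ : ℕ∞) Ψ v :=
    P.contDiff.contDiffAt.prodMk hRQ
  let L : V →L[ℝ] W × (K →L[ℝ] ℝ) := P.prod (R.comp (fderiv ℝ (fderiv ℝ Q) v))
  have hL : HasFDerivAt Ψ L v :=
    P.hasFDerivAt.prodMk (R.hasFDerivAt.comp v (hQ2.differentiableAt (by simp)).hasFDerivAt)
  have hinj : Function.Injective (L : V →ₗ[ℝ] W × (K →L[ℝ] ℝ)) := by
    rw [injective_iff_map_eq_zero]
    intro u hu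
    by_contra hu0
    have h1 : P u = 0 := congrArg Prod.fst hu
    have h2 : R (fderiv ℝ (fderiv ℝ Q) v u) = 0 := congrArg Prod.snd hu
    obtain ⟨x, hx⟩ := hj u h1
    have h3 := hR (fderiv ℝ (fderiv ℝ Q) v u) x
    rw [h2, hx] at h3
    have := h.hess_pos hv hu0
    simp only [ContinuousLinearMap.zero_apply] at h3
    exact absurd h3 this.ne
  have hdim : Module.finrank ℝ V = Module.finrank ℝ (W × (K →L[ℝ] ℝ)) := by
    have e1 : Module.finrank ℝ (K →L[ℝ] ℝ) = Module.finrank ℝ K := by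
      rw [← (LinearMap.toContinuousLinearMap (𝕜 := ℝ) (E := K) (F' := ℝ)).finrank_eq]
      exact Subspace.dual_finrank_eq
    rw [Module.finrank_prod, e1, hdim0]
  let e : V ≃L[ℝ] W × (K →L[ℝ] ℝ) :=
    ((L : V →ₗ[ℝ] W × (K →L[ℝ] ℝ)).linearEquivOfInjective hinj hdim).toContinuousLinearEquiv
  have he : (e : V →L[ℝ] W × (K →L[ℝ] ℝ)) = L := by
    ext1 x
    rfl
  have hL' : HasFDerivAt Ψ (e : V →L[ℝ] W × (K →L[ℝ] ℝ)) v := by rw [he]; exact hL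
  have hn : ((⊤ : ℕ∞) : WithTop ℕ∞) ≠ 0 := by simp
  have hΨv : Ψ v = (P v, 0) := by
    refine Prod.ext rfl ?_
    ext k
    exact hcrit _ (hPj k)
  let ι : W → W × (K →L[ℝ] ℝ) := fun w => (w, 0)
  have hι : ContDiff ℝ (⊤ : ℕ∞) ι := contDiff_id.prodMk contDiff_const
  have hιv : ι (P v) = Ψ v := hΨv.symm
  refine ⟨fun w => hΨ.localInverse hL' hn (ι w), ?_, ?_, ?_⟩
  · show hΨ.localInverse hL' hn (ι (P v)) = v
    rw [hιv]
    exact hΨ.localInverse_apply_image hL' hn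
  · refine ContDiffAt.comp (P v) ?_ hι.contDiffAt
    rw [hιv]
    exact hΨ.to_localInverse hL' hn
  · have hev : ∀ᶠ y in 𝓝 (Ψ v), Ψ (hΨ.localInverse hL' hn y) = y :=
      (hΨ.hasStrictFDerivAt' hL' hn).eventually_right_inverse
    have ht : Tendsto ι (𝓝 (P v)) (𝓝 (Ψ v)) := by
      rw [← hιv]
      exact hι.continuous.continuousAt
    filter_upwards [ht.eventually hev] with w hw
    refine ⟨congrArg Prod.fst hw, fun k hk => ?_⟩
    have h2 : R (fderiv ℝ Q (hΨ.localInverse hL' hn (ι w))) = 0 := congrArg Prod.snd hw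
    obtain ⟨x, hx⟩ := hj k hk
    have h3 := hR (fderiv ℝ Q (hΨ.localInverse hL' hn (ι w))) x
    rw [h2, hx] at h3
    exact h3.symm

theorem IsMinkowskiNorm.exists_section [FiniteDimensional ℝ V] [FiniteDimensional ℝ W] {F : V → ℝ}
    (h : IsMinkowskiNorm F) (P : V →L[ℝ] W) (hP : Function.Surjective P)
    {v : V} (hv : v ≠ 0) (hcrit : ∀ k, P k = 0 → fderiv ℝ (fun x => F x ^ 2) v k = 0) :
    ∃ g : W → V, g (P v) = v ∧ ContDiffAt ℝ (⊤ : ℕ∞) g (P v) ∧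
      ∀ᶠ w in 𝓝 (P v), P (g w) = w ∧ ∀ k, P k = 0 → fderiv ℝ (fun x => F x ^ 2) (g w) k = 0 := by
  refine h.exists_section_aux P (LinearMap.ker (P : V →ₗ[ℝ] W)).subtypeL
    (fun k hk => ⟨⟨k, hk⟩, rfl⟩) (fun x => x.2) ?_ hv hcrit
  have e2 := (P : V →ₗ[ℝ] W).finrank_range_add_finrank_ker
  rw [LinearMap.range_eq_top.2 hP, finrank_top] at e2
  exact e2.symm

theorem IsMinkowskiNorm.unique_of_ball {F G : V → ℝ} (hF : IsMinkowskiNorm F)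
    (hG : IsMinkowskiNorm G) (hFG : ∀ v, F v ≤ 1 → G v ≤ 1) (v : V) : G v ≤ F v := by
  by_cases hv : v = 0
  · rw [hv, hF.map_zero, hG.map_zero]
  have hp := hF.pos v hv
  have := hFG ((F v)⁻¹ • v) (by rw [hF.pos_homog _ (inv_pos.2 hp), inv_mul_cancel₀ hp.ne'])
  rw [hG.pos_homog _ (inv_pos.2 hp), inv_mul_eq_div, div_le_one hp] at this
  exact this

theorem IsMinkowskiNorm.subduced [FiniteDimensional ℝ V] [FiniteDimensional ℝ W] {F : V → ℝ}
    (h : IsMinkowskiNorm F) (P : V →L[ℝ] W) (hP : Function.Surjective P) (σ : W → V)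
    (hσ : ∀ w, P (σ w) = w) (hmin : ∀ w v', P v' = w → F (σ w) ≤ F v') :
    IsMinkowskiNorm (fun w => F (σ w)) := by
  have hσ0 : ∀ w, w ≠ 0 → σ w ≠ 0 := by
    intro w hw h0
    apply hw
    rw [← hσ w, h0, P.map_zero]
  have hz : F (σ 0) = 0 :=
    le_antisymm ((hmin 0 0 P.map_zero).trans h.map_zero.le) (h.nonneg _)
  have hle : ∀ c : ℝ, 0 < c → ∀ w, F (σ (c • w)) ≤ c * F (σ w) := by
    intro c hc w
    rw [← h.pos_homog c hc]
    exact hmin _ _ (by rw [map_smul, hσ])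
  have key : ∀ w, w ≠ 0 → ∃ g : W → V, g w = σ w ∧ ContDiffAt ℝ (⊤ : ℕ∞) g w ∧
      (∀ᶠ x in 𝓝 w, P (g x) = x ∧ ∀ k, P k = 0 → fderiv ℝ (fun x => F x ^ 2) (g x) k = 0) ∧
      (fun x => F (σ x)) =ᶠ[𝓝 w] fun x => F (g x) := by
    intro w hw
    obtain ⟨g, hg1, hg2, hg3⟩ := h.exists_section P hP (hσ0 w hw)
      (fun k hk => h.crit_of_min P (hσ0 w hw) (by rw [hσ]; exact hmin w) hk)
    rw [hσ] at hg1 hg2 hg3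
    refine ⟨g, hg1, hg2, hg3, ?_⟩
    filter_upwards [hg3, isOpen_ne.mem_nhds hw] with x hx hx0
    refine le_antisymm (hmin x _ hx.1) (h.min_of_crit P (by rw [hx.1]; exact hx0) ?_ hx.2)
    rw [hσ, hx.1]
  have hsm : ∀ w, w ≠ 0 → ContDiffAt ℝ (⊤ : ℕ∞) (fun w => F (σ w)) w := by
    intro w hw
    obtain ⟨g, hg1, hg2, hg3, hg4⟩ := key w hw
    refine ContDiffAt.congr_of_eventuallyEq ?_ hg4
    refine ContDiffAt.comp w ?_ hg2
    rw [hg1]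
    exact h.contDiffAt (hσ0 w hw)
  refine ⟨?_, hz, fun y hy => h.pos _ (hσ0 y hy), ?_, ?_, ?_⟩
  · rw [continuous_iff_continuousAt]
    intro w
    by_cases hw : w = 0
    · subst hw
      obtain ⟨s, hs⟩ := P.exists_rightInverse_of_surjective (LinearMap.range_eq_top.2 hP)
      have hs' : ∀ w, P (s w) = w := fun w => DFunLike.congr_fun hs w
      have hc : Tendsto (fun w => F (s w)) (𝓝 0) (𝓝 0) := by
        have := (h.continuous.comp s.continuous).tendsto 0
        simpa [h.map_zero, Function.comp_def] using this
      show Tendsto (fun w => F (σ w)) (𝓝 0) (𝓝 (F (σ 0)))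
      rw [hz]
      exact tendsto_of_tendsto_of_tendsto_of_le_of_le tendsto_const_nhds hc
        (fun w => h.nonneg _) (fun w => hmin w _ (hs' w))
    · exact (hsm w hw).continuousAt
  · intro c hc w
    refine le_antisymm (hle c hc w) ?_
    have := hle c⁻¹ (inv_pos.2 hc) (c • w)
    rw [smul_smul, inv_mul_cancel₀ hc.ne', one_smul, inv_mul_eq_div, le_div_iff₀ hc] at this
    show c * F (σ w) ≤ F (σ (c • w))
    linarith
  · exact fun w hw => (hsm w hw).contDiffWithinAt
  · intro w hw u hu
    obtain ⟨g, hg1, hg2, hg3, hg4⟩ := key w hw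
    set Q : V → ℝ := fun x => F x ^ 2 with hQ
    have hgd : ∀ᶠ x in 𝓝 w, DifferentiableAt ℝ g x := by
      have h1 : ContDiffAt ℝ 1 g w := hg2.of_le (WithTop.coe_le_coe.2 le_top)
      filter_upwards [h1.eventually (by simp)] with x hx
      exact hx.differentiableAt (by simp)
    have hPg : ∀ᶠ x in 𝓝 w, ∀ a, P (fderiv ℝ g x a) = a := by
      have h1 : ∀ᶠ x in 𝓝 w, ∀ᶠ y in 𝓝 x, P (g y) = y :=
        (hg3.mono fun x hx => hx.1).eventually_nhds
      filter_upwards [h1, hgd] with x hx hxd a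
      have e1 : HasFDerivAt (fun y => P (g y)) (P.comp (fderiv ℝ g x)) x :=
        P.hasFDerivAt.comp x hxd.hasFDerivAt
      have e2 : HasFDerivAt (fun y => P (g y)) (ContinuousLinearMap.id ℝ W) x :=
        (hasFDerivAt_id x).congr_of_eventuallyEq hx
      exact DFunLike.congr_fun (e1.unique e2) a
    set a := fderiv ℝ g w u with ha
    have hPa : P a = u := hPg.self_of_nhds u
    have ha0 : a ≠ 0 := by
      intro h0
      apply hu
      rw [← hPa, h0, P.map_zero]
    have hQg : (fun x => F (σ x) ^ 2) =ᶠ[𝓝 w] fun x => Q (g x) :=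
      hg4.mono fun x hx => by
        have hx' : F (σ x) = F (g x) := hx
        simp only [hQ, hx']
    have hfd : (fun x => fderiv ℝ (fun x => F (σ x) ^ 2) x u) =ᶠ[𝓝 w]
        fun x => fderiv ℝ Q (g x) a := by
      filter_upwards [hQg.eventuallyEq_nhds, hgd, hPg, hg3, isOpen_ne.mem_nhds hw]
        with x h1 h2 h3 h4 h5
      have hgx : g x ≠ 0 := by
        intro h0
        apply h5
        rw [← h4.1, h0, P.map_zero]
      have hQd := ((h.contDiffAt_sq hgx).differentiableAt (by simp)).hasFDerivAt
      have hcomp : HasFDerivAt (fun x => Q (g x)) ((fderiv ℝ Q (g x)).comp (fderiv ℝ g x)) x :=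
        hQd.comp x h2.hasFDerivAt
      rw [h1.fderiv_eq, hcomp.fderiv, ContinuousLinearMap.comp_apply, ← sub_eq_zero, ← map_sub]
      exact h4.2 _ (by rw [map_sub, h3, hPa, sub_self])
    have hs2 : ContDiffAt ℝ (⊤ : ℕ∞) (fun x => F (σ x) ^ 2) w := (hsm w hw).pow 2
    have hs3 : ContDiffAt ℝ (⊤ : ℕ∞) (fderiv ℝ (fun x => F (σ x) ^ 2)) w :=
      hs2.fderiv_right (by rfl)
    have d1 : HasFDerivAt (fun x => fderiv ℝ (fun x => F (σ x) ^ 2) x u)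
        ((fderiv ℝ (fderiv ℝ (fun x => F (σ x) ^ 2)) w).flip u) w :=
      ((hs3.differentiableAt (by simp)).hasFDerivAt.clm_apply (hasFDerivAt_const u w)).congr_fderiv
        (by simp)
    have hQ2 : HasFDerivAt (fderiv ℝ Q) (fderiv ℝ (fderiv ℝ Q) (σ w)) (g w) := by
      rw [hg1]
      have : ContDiffAt ℝ (⊤ : ℕ∞) (fderiv ℝ Q) (σ w) :=
        (h.contDiffAt_sq (hσ0 w hw)).fderiv_right (by rfl)
      exact (this.differentiableAt (by simp)).hasFDerivAt
    have d2 : HasFDerivAt (fun x => fderiv ℝ Q (g x) a)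
        (((fderiv ℝ (fderiv ℝ Q) (σ w)).comp (fderiv ℝ g w)).flip a) w :=
      ((hQ2.comp w hgd.self_of_nhds.hasFDerivAt).clm_apply (hasFDerivAt_const a w)).congr_fderiv
        (by simp)
    have heq := DFunLike.congr_fun (d1.unique (d2.congr_of_eventuallyEq hfd)) u
    have hpos := h.hess_pos (hσ0 w hw) ha0
    rw [iteratedFDeriv_two_apply]
    simp only [ContinuousLinearMap.flip_apply, ContinuousLinearMap.comp_apply] at heq
    have : fderiv ℝ (fderiv ℝ (fun x => F (σ x) ^ 2)) w u u > 0 := by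
      rw [heq]
      exact hpos
    simpa using this

end helpers

/-- Given a Minkowski norm F1 on V1 and a surjective linear map pi : V1 -> V2,
there is a unique Minkowski norm F2 on V2 such that pi maps the unit ball of F1
onto the unit ball of F2, i.e. such that pi is an isometric submersion. -/
theorem exists_unique_subduced_norm
    {V1 V2 : Type*} [NormedAddCommGroup V1] [NormedSpace ℝ V1] [FiniteDimensional ℝ V1]
    [NormedAddCommGroup V2] [NormedSpace ℝ V2] [FiniteDimensional ℝ V2]
    (F1 : V1 → ℝ) (hF1 : IsMinkowskiNorm F1)
    (π : V1 →ₗ[ℝ] V2) (hπ : Function.Surjective π) :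
    ∃! F2 : V2 → ℝ, IsMinkowskiNorm F2 ∧ π '' {v | F1 v ≤ 1} = {w | F2 w ≤ 1} := by
  let P : V1 →L[ℝ] V2 := LinearMap.toContinuousLinearMap π
  have hPS : Function.Surjective P := hπ
  choose σ hσ hmin using hF1.exists_min P hPS
  have hF2 := hF1.subduced P hPS σ hσ hmin
  have hball : π '' {v | F1 v ≤ 1} = {w | F1 (σ w) ≤ 1} := by
    ext w
    constructor
    · rintro ⟨v, hv, rfl⟩
      exact (hmin _ v rfl).trans hv
    · intro hw
      exact ⟨σ w, hw, hσ w⟩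
  refine ⟨fun w => F1 (σ w), ⟨hF2, hball⟩, ?_⟩
  rintro G ⟨hG, hGb⟩
  rw [hball] at hGb
  funext w
  exact le_antisymm (hF2.unique_of_ball hG (fun v hv => hGb.subset hv) w)
    (hG.unique_of_ball hF2 (fun v hv => hGb.symm.subset hv) w)
end

section
/- (Proposition 2.3) Let π : (V1,F1) → (V2,F2) be an isometric submersion between finite-dimensional real vector spaces equipped with Minkowski norms, let w ∈ V2 be nonzero, and let v ∈ V1 be the horizontal lift of w (the unique vector with π(v) = w attaining inf { F1(x) | π(x) = w }). Then π is an isometric submersion between the Euclidean spaces (V1, g_v^{F1}) and (V2, g_w^{F2}); that is, π maps the ellipsoid { x ∈ V1 | g_v^{F1}(x,x) ≤ 1 } onto the ellipsoid { y ∈ V2 | g_w^{F2}(y,y) ≤ 1 }, where g_v^{F1}(u,u') := (1/2)·D²(F1²)(v)(u,u') and g_w^{F2}(u,u') := (1/2)·D²(F2²)(w)(u,u'). -/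
open Filter Topology in
lemma aux_fsq_contDiffOn {V : Type*} [NormedAddCommGroup V] [NormedSpace ℝ V]
    {F : V → ℝ} (hF : IsMinkowskiNorm F) :
    ContDiffOn ℝ (⊤ : ℕ∞) (fun z => F z ^ 2) {y | y ≠ 0} := hF.smooth.pow 2

lemma aux_open {V : Type*} [NormedAddCommGroup V] : IsOpen {y : V | y ≠ 0} := isOpen_ne

lemma aux_diff {V : Type*} [NormedAddCommGroup V] [NormedSpace ℝ V]
    {F : V → ℝ} (hF : IsMinkowskiNorm F) {z : V} (hz : z ≠ 0) :
    DifferentiableAt ℝ (fun z => F z ^ 2) z :=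
  ((aux_fsq_contDiffOn hF).contDiffAt (aux_open.mem_nhds hz)).differentiableAt (by simp)

lemma aux_fd_contDiffOn {V : Type*} [NormedAddCommGroup V] [NormedSpace ℝ V]
    {F : V → ℝ} (hF : IsMinkowskiNorm F) :
    ContDiffOn ℝ 1 (fderiv ℝ (fun z => F z ^ 2)) {y | y ≠ 0} :=
  (aux_fsq_contDiffOn hF).fderiv_of_isOpen aux_open (by norm_cast)

lemma aux_diff2 {V : Type*} [NormedAddCommGroup V] [NormedSpace ℝ V]
    {F : V → ℝ} (hF : IsMinkowskiNorm F) {z : V} (hz : z ≠ 0) :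
    DifferentiableAt ℝ (fderiv ℝ (fun z => F z ^ 2)) z :=
  ((aux_fd_contDiffOn hF).contDiffAt (aux_open.mem_nhds hz)).differentiableAt (by simp)

/-- The Hessian quadratic form `D²(F²)(z)(u,u)`. -/
noncomputable def auxH {V : Type*} [NormedAddCommGroup V] [NormedSpace ℝ V]
    (F : V → ℝ) (z u : V) : ℝ := fderiv ℝ (fderiv ℝ (fun z => F z ^ 2)) z u u

lemma auxH_smul {V : Type*} [NormedAddCommGroup V] [NormedSpace ℝ V]
    (F : V → ℝ) (z u : V) (c : ℝ) : auxH F z (c • u) = c ^ 2 * auxH F z u := by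
  simp [auxH]; ring

lemma auxH_contOn {V : Type*} [NormedAddCommGroup V] [NormedSpace ℝ V]
    {F : V → ℝ} (hF : IsMinkowskiNorm F) :
    ContinuousOn (fun p : V × V => auxH F p.1 p.2) {p | p.1 ≠ 0} := by
  have h1 : ContinuousOn (fderiv ℝ (fderiv ℝ (fun z => F z ^ 2))) {y | y ≠ 0} :=
    (aux_fd_contDiffOn hF).continuousOn_fderiv_of_isOpen aux_open le_rfl
  have h2 : ContinuousOn (fun p : V × V => fderiv ℝ (fderiv ℝ (fun z => F z ^ 2)) p.1)
      {p | p.1 ≠ 0} := h1.comp continuousOn_fst (fun p hp => hp)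
  exact (h2.clm_apply continuousOn_snd).clm_apply continuousOn_snd

open Filter Topology in
lemma auxH_tendsto {V : Type*} [NormedAddCommGroup V] [NormedSpace ℝ V]
    {F : V → ℝ} (hF : IsMinkowskiNorm F) {z u : V} (hz : z ≠ 0) {a b : ℕ → V}
    (ha : Tendsto a atTop (𝓝 z)) (hb : Tendsto b atTop (𝓝 u)) :
    Tendsto (fun n => auxH F (a n) (b n)) atTop (𝓝 (auxH F z u)) := by
  have ho : IsOpen {p : V × V | p.1 ≠ 0} := aux_open.preimage continuous_fst
  have h := (auxH_contOn hF).continuousAt (x := (z, u)) (ho.mem_nhds hz)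
  exact h.tendsto.comp (ha.prodMk_nhds hb)

lemma auxH_pos {V : Type*} [NormedAddCommGroup V] [NormedSpace ℝ V]
    {F : V → ℝ} (hF : IsMinkowskiNorm F) {z u : V} (hz : z ≠ 0) (hu : u ≠ 0) :
    0 < auxH F z u := by
  have := hF.posdef z hz u hu
  rw [iteratedFDeriv_two_apply] at this
  simp at this
  exact this

lemma aux_lagrange {V : Type*} [NormedAddCommGroup V] [NormedSpace ℝ V]
    {F : V → ℝ} (hF : IsMinkowskiNorm F) (x d : V)
    (hs : ∀ s ∈ Set.Icc (0 : ℝ) 1, x + s • d ≠ 0) :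
    ∃ s ∈ Set.Ioo (0 : ℝ) 1, F (x + d) ^ 2 =
      F x ^ 2 + fderiv ℝ (fun z => F z ^ 2) x d + (1 / 2) * auxH F (x + s • d) d := by
  have hl : ∀ s : ℝ, HasDerivAt (fun s : ℝ => x + s • d) d s := fun s => by
    simpa using ((hasDerivAt_id s).smul_const d).const_add x
  have h0 : ∀ s ∈ Set.Icc (0 : ℝ) 1, HasDerivAt (fun s : ℝ => F (x + s • d) ^ 2)
      (fderiv ℝ (fun z => F z ^ 2) (x + s • d) d) s := fun s hs' =>
    HasFDerivAt.comp_hasDerivAt (l := fun z => F z ^ 2) s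
      (aux_diff hF (hs s hs')).hasFDerivAt (hl s)
  have h1 : ∀ s ∈ Set.Icc (0 : ℝ) 1,
      HasDerivAt (fun s : ℝ => fderiv ℝ (fun z => F z ^ 2) (x + s • d) d)
      (auxH F (x + s • d) d) s := fun s hs' => by
    have hA : HasDerivAt (fun s : ℝ => fderiv ℝ (fun z => F z ^ 2) (x + s • d))
        (fderiv ℝ (fderiv ℝ (fun z => F z ^ 2)) (x + s • d) d) s :=
      HasFDerivAt.comp_hasDerivAt (l := fderiv ℝ (fun z => F z ^ 2)) s
        (aux_diff2 hF (hs s hs')).hasFDerivAt (hl s)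
    have hB := hA.clm_apply (hasDerivAt_const s d)
    rw [map_zero, add_zero] at hB
    exact hB
  have hf : ∀ s ∈ Set.Icc (0 : ℝ) 1, HasDerivAt
      (fun s : ℝ => F (x + s • d) ^ 2 + (1 - s) * fderiv ℝ (fun z => F z ^ 2) (x + s • d) d)
      ((1 - s) * auxH F (x + s • d) d) s := fun s hs' => by
    have := (h0 s hs').add (((hasDerivAt_id s).const_sub 1).mul (h1 s hs'))
    refine this.congr_deriv ?_
    simp only [id]; ring
  have hg : ∀ s : ℝ, HasDerivAt (fun s : ℝ => -((1 - s) ^ 2 / 2)) (1 - s) s := fun s => by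
    have := ((((hasDerivAt_id s).const_sub 1).pow 2).div_const 2).neg
    refine this.congr_deriv ?_
    simp only [id]; norm_num; ring
  obtain ⟨c, hc, h⟩ := exists_ratio_hasDerivAt_eq_ratio_slope
    (fun s : ℝ => F (x + s • d) ^ 2 + (1 - s) * fderiv ℝ (fun z => F z ^ 2) (x + s • d) d)
    (fun s => (1 - s) * auxH F (x + s • d) d) (zero_lt_one (α := ℝ))
    (fun s hs' => (hf s hs').continuousAt.continuousWithinAt)
    (fun s hs' => hf s ⟨hs'.1.le, hs'.2.le⟩)
    (fun s : ℝ => -((1 - s) ^ 2 / 2)) (fun s => 1 - s)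
    (fun s hs' => (hg s).continuousAt.continuousWithinAt)
    (fun s hs' => hg s)
  refine ⟨c, hc, ?_⟩
  have hc1 : (1 - c) ≠ 0 := by have := hc.2; intro h; linarith
  simp only [one_smul, zero_smul, add_zero] at h
  apply mul_left_cancel₀ hc1
  linarith

lemma aux_lower {V : Type*} [NormedAddCommGroup V] [NormedSpace ℝ V] [FiniteDimensional ℝ V]
    {F : V → ℝ} (hF : IsMinkowskiNorm F) : ∃ b > 0, ∀ x, b * ‖x‖ ≤ F x := by
  obtain ⟨b, hb, h⟩ := (isCompact_sphere (0 : V) 1).exists_forall_le' (a := (0 : ℝ))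
    hF.continuous.continuousOn (fun x hx => hF.pos x (by
      rintro rfl; simp at hx))
  refine ⟨b, hb, fun x => ?_⟩
  by_cases hx : x = 0
  · simp [hx, hF.map_zero]
  have hn : 0 < ‖x‖ := norm_pos_iff.2 hx
  have h1 := h (‖x‖⁻¹ • x) (by simp [norm_smul, hn.ne'])
  rw [hF.pos_homog _ (inv_pos.2 hn)] at h1
  calc b * ‖x‖ ≤ (‖x‖⁻¹ * F x) * ‖x‖ := by gcongr
    _ = F x := by field_simp

/-- Uniform positivity of the Hessian on a compact set avoiding `0`. -/
lemma auxH_lower {V : Type*} [NormedAddCommGroup V] [NormedSpace ℝ V] [FiniteDimensional ℝ V]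
    {F : V → ℝ} (hF : IsMinkowskiNorm F) {K : Set V} (hK : IsCompact K)
    (hK0 : ∀ z ∈ K, z ≠ 0) : ∃ a > 0, ∀ z ∈ K, ∀ u, a * ‖u‖ ^ 2 ≤ auxH F z u := by
  obtain ⟨b, hb, h⟩ := (hK.prod (isCompact_sphere (0 : V) 1)).exists_forall_le' (a := (0 : ℝ))
    ((auxH_contOn hF).mono (fun p hp => hK0 _ hp.1)) (fun p hp => auxH_pos hF (hK0 _ hp.1) (by
      intro h0; have := hp.2; simp [h0] at this))
  refine ⟨b, hb, fun z hz u => ?_⟩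
  by_cases hx : u = 0
  · simp [hx, auxH]
  have hn : 0 < ‖u‖ := norm_pos_iff.2 hx
  have h1 := h (z, ‖u‖⁻¹ • u) ⟨hz, by simp [norm_smul, hn.ne']⟩
  simp only [auxH_smul] at h1
  calc b * ‖u‖ ^ 2 ≤ (‖u‖⁻¹ ^ 2 * auxH F z u) * ‖u‖ ^ 2 := by gcongr
    _ = _ := by field_simp

section
variable {V1 V2 : Type*} [NormedAddCommGroup V1] [NormedSpace ℝ V1] [FiniteDimensional ℝ V1]
    [NormedAddCommGroup V2] [NormedSpace ℝ V2] [FiniteDimensional ℝ V2]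

lemma aux_le {F1 : V1 → ℝ} {F2 : V2 → ℝ}
    (hF1 : IsMinkowskiNorm F1) (hF2 : IsMinkowskiNorm F2) (π : V1 →ₗ[ℝ] V2)
    (hsub : π '' {v | F1 v ≤ 1} = {w | F2 w ≤ 1}) (x : V1) : F2 (π x) ≤ F1 x := by
  by_cases hx : x = 0
  · simp [hx, hF1.map_zero, hF2.map_zero]
  have hp := hF1.pos x hx
  have : π ((F1 x)⁻¹ • x) ∈ {w | F2 w ≤ 1} := by
    rw [← hsub]
    refine ⟨_, ?_, rfl⟩
    simp [hF1.pos_homog _ (inv_pos.2 hp), hp.ne']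
  simp only [Set.mem_ofPred_eq, map_smul, hF2.pos_homog _ (inv_pos.2 hp)] at this
  rwa [inv_mul_le_iff₀ hp, mul_one] at this

lemma aux_lift {F1 : V1 → ℝ} {F2 : V2 → ℝ}
    (hF1 : IsMinkowskiNorm F1) (hF2 : IsMinkowskiNorm F2) (π : V1 →ₗ[ℝ] V2)
    (hsub : π '' {v | F1 v ≤ 1} = {w | F2 w ≤ 1}) (y : V2) (hy : y ≠ 0) :
    ∃ x, π x = y ∧ F1 x = F2 y := by
  have hp := hF2.pos y hy
  have : (F2 y)⁻¹ • y ∈ π '' {v | F1 v ≤ 1} := by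
    rw [hsub]
    simp [hF2.pos_homog _ (inv_pos.2 hp), hp.ne']
  obtain ⟨x, hx, hxy⟩ := this
  have hxy' : π (F2 y • x) = y := by simp [hxy, hp.ne']
  refine ⟨F2 y • x, hxy', le_antisymm ?_ ?_⟩
  · rw [hF1.pos_homog _ hp]
    exact mul_le_of_le_one_right hp.le hx
  · have := aux_le hF1 hF2 π hsub (F2 y • x)
    rwa [hxy'] at this

lemma aux_min {F1 : V1 → ℝ} {F2 : V2 → ℝ}
    (hF1 : IsMinkowskiNorm F1) (hF2 : IsMinkowskiNorm F2) (π : V1 →ₗ[ℝ] V2)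
    (hsub : π '' {v | F1 v ≤ 1} = {w | F2 w ≤ 1})
    (w : V2) (hw : w ≠ 0) (v : V1) (hv : π v = w)
    (hmin : F1 v = sInf (F1 '' {x | π x = w})) : F1 v = F2 w := by
  apply le_antisymm
  · obtain ⟨x, hx, hx2⟩ := aux_lift hF1 hF2 π hsub w hw
    rw [hmin, ← hx2]
    refine csInf_le ⟨F2 w, ?_⟩ ⟨x, hx, rfl⟩
    rintro _ ⟨z, hz, rfl⟩
    have := aux_le hF1 hF2 π hsub z
    rwa [hz] at this
  · rw [← hv]; exact aux_le hF1 hF2 π hsub v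

lemma aux_nonneg {V : Type*} [NormedAddCommGroup V] [NormedSpace ℝ V]
    {F : V → ℝ} (hF : IsMinkowskiNorm F) (x : V) : 0 ≤ F x := by
  by_cases hx : x = 0
  · simp [hx, hF.map_zero]
  · exact (hF.pos x hx).le

lemma aux_crit {F1 : V1 → ℝ} {F2 : V2 → ℝ}
    (hF1 : IsMinkowskiNorm F1) (hF2 : IsMinkowskiNorm F2) (π : V1 →ₗ[ℝ] V2)
    (hle : ∀ x, F2 (π x) ^ 2 ≤ F1 x ^ 2) (w : V2) (hw : w ≠ 0) (v : V1) (hv : π v = w)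
    (heq : F1 v = F2 w) (d : V1) :
    fderiv ℝ (fun z => F1 z ^ 2) v d = fderiv ℝ (fun z => F2 z ^ 2) w (π d) := by
  have hv0 : v ≠ 0 := by rintro rfl; simp at hv; exact hw hv.symm
  subst hv
  have h1 := (aux_diff hF1 hv0).hasFDerivAt
  have h2 := HasFDerivAt.comp v (g := fun z => F2 z ^ 2) (aux_diff hF2 hw).hasFDerivAt
    π.toContinuousLinearMap.hasFDerivAt
  have hm : IsLocalMin ((fun z => F1 z ^ 2) - (fun z => F2 z ^ 2) ∘ π.toContinuousLinearMap) v := by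
    refine Filter.Eventually.of_forall fun x => ?_
    have := hle x
    simp [heq, this]
  have := hm.hasFDerivAt_eq_zero (h1.sub h2)
  have := congrArg (fun f => f d) this
  simp at this
  linarith

lemma aux_ne {w y : V2} (hw : w ≠ 0) {s : ℝ} (h : ‖s • y‖ ≤ ‖w‖ / 2) : w + s • y ≠ 0 := by
  intro h0
  have : w = - (s • y) := eq_neg_of_add_eq_zero_left h0
  have h1 : ‖w‖ = ‖s • y‖ := by conv_lhs => rw [this, norm_neg]
  have := norm_pos_iff.2 hw
  linarith

open Filter Topology in
lemma aux_seq {w : V2} (hw : w ≠ 0) (y : V2) : ∃ t : ℕ → ℝ, (∀ n, 0 < t n) ∧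
    Tendsto t atTop (𝓝 0) ∧ ∀ n, ‖t n • y‖ ≤ ‖w‖ / 2 := by
  have hwp := norm_pos_iff.2 hw
  have hy : 0 < ‖y‖ + 1 := by positivity
  refine ⟨fun n => ‖w‖ / (2 * (‖y‖ + 1)) * (1 / ((n : ℝ) + 1)), fun n => by positivity, ?_, ?_⟩
  · simpa using tendsto_one_div_add_atTop_nhds_zero_nat.const_mul (‖w‖ / (2 * (‖y‖ + 1)))
  · intro n
    rw [norm_smul, Real.norm_of_nonneg (by positivity)]
    have h1 : 1 / ((n : ℝ) + 1) ≤ 1 := by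
      rw [div_le_one (by positivity)]; linarith [Nat.cast_nonneg (α := ℝ) n]
    calc ‖w‖ / (2 * (‖y‖ + 1)) * (1 / ((n : ℝ) + 1)) * ‖y‖
        ≤ ‖w‖ / (2 * (‖y‖ + 1)) * 1 * (‖y‖ + 1) := by gcongr; linarith
      _ = ‖w‖ / 2 := by field_simp

lemma aux_seg {s t : ℝ} {y : V2} {M : ℝ} (hs : s ∈ Set.Icc (0 : ℝ) 1) (h : ‖t • y‖ ≤ M) :
    ‖s • t • y‖ ≤ M := by
  rw [norm_smul, Real.norm_of_nonneg hs.1]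
  exact (mul_le_of_le_one_left (norm_nonneg _) hs.2).trans h

open Filter Topology in
lemma aux_tend {V : Type*} [NormedAddCommGroup V] [NormedSpace ℝ V] {s : ℕ → ℝ} {d : ℕ → V}
    (x : V) (hs : ∀ n, s n ∈ Set.Ioo (0 : ℝ) 1) (hd : Tendsto d atTop (𝓝 0)) :
    Tendsto (fun n => x + s n • d n) atTop (𝓝 x) := by
  have : Tendsto (fun n => s n • d n) atTop (𝓝 0) := by
    refine squeeze_zero_norm (fun n => ?_) (tendsto_zero_iff_norm_tendsto_zero.1 hd)
    rw [norm_smul, Real.norm_of_nonneg (hs n).1.le]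
    exact mul_le_of_le_one_left (norm_nonneg _) (hs n).2.le
  simpa using this.const_add x

open Filter Topology in
lemma aux_main {F1 : V1 → ℝ} {F2 : V2 → ℝ}
    (hF1 : IsMinkowskiNorm F1) (hF2 : IsMinkowskiNorm F2) (π : V1 →ₗ[ℝ] V2)
    (hsub : π '' {v | F1 v ≤ 1} = {w | F2 w ≤ 1})
    (w : V2) (hw : w ≠ 0) (v : V1) (hv : π v = w) (heq : F1 v = F2 w) :
    (∀ x, auxH F2 w (π x) ≤ auxH F1 v x) ∧
    ∀ y, ∃ x, π x = y ∧ auxH F1 v x = auxH F2 w y := by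
  have hle : ∀ x, F2 (π x) ^ 2 ≤ F1 x ^ 2 := fun x =>
    pow_le_pow_left₀ (aux_nonneg hF2 _) (aux_le hF1 hF2 π hsub x) 2
  have hcrit := aux_crit hF1 hF2 π hle w hw v hv heq
  have hv0 : v ≠ 0 := by rintro rfl; simp at hv; exact hw hv.symm
  have hπ0 : ∀ z, π z ≠ 0 → z ≠ 0 := by rintro z hz rfl; simp at hz
  constructor
  · intro x
    obtain ⟨t, ht, ht0, hty⟩ := aux_seq hw (π x)
    have hne2 : ∀ n, ∀ s ∈ Set.Icc (0 : ℝ) 1, w + s • t n • π x ≠ 0 := fun n s hs => by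
      have := aux_seg hs (hty n)
      rw [smul_smul] at this ⊢
      exact aux_ne hw this
    have hne1 : ∀ n, ∀ s ∈ Set.Icc (0 : ℝ) 1, v + s • t n • x ≠ 0 := fun n s hs =>
      hπ0 _ (by simpa [hv] using hne2 n s hs)
    choose a ha ha' using fun n => aux_lagrange hF1 v (t n • x) (hne1 n)
    choose b hb hb' using fun n => aux_lagrange hF2 w (t n • π x) (hne2 n)
    have hx0 : Tendsto (fun n => t n • x) atTop (𝓝 0) := by simpa using ht0.smul_const x
    have hy0 : Tendsto (fun n => t n • π x) atTop (𝓝 0) := by simpa using ht0.smul_const (π x)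
    refine le_of_tendsto_of_tendsto'
      (auxH_tendsto hF2 hw (aux_tend w hb hy0) tendsto_const_nhds)
      (auxH_tendsto hF1 hv0 (aux_tend v ha hx0) tendsto_const_nhds) fun n => ?_
    have h1 := hle (v + t n • x)
    have h2 := hcrit (t n • x)
    rw [map_smul π] at h2
    rw [map_add, map_smul, hv, ha' n, hb' n, h2, heq, auxH_smul, auxH_smul] at h1
    have : t n ^ 2 * auxH F2 (w + b n • t n • π x) (π x) ≤
      t n ^ 2 * auxH F1 (v + a n • t n • x) x := by linarith
    exact le_of_mul_le_mul_left this (pow_pos (ht n) 2)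
  · intro y
    obtain ⟨t, ht, ht0, hty⟩ := aux_seq hw y
    have hne2 : ∀ n, ∀ s ∈ Set.Icc (0 : ℝ) 1, w + s • t n • y ≠ 0 := fun n s hs => by
      have := aux_seg hs (hty n)
      rw [smul_smul] at this ⊢
      exact aux_ne hw this
    choose X hX hX' using fun n => aux_lift hF1 hF2 π hsub (w + t n • y) (aux_ne hw (hty n))
    have hy0 : Tendsto (fun n => t n • y) atTop (𝓝 0) := by simpa using ht0.smul_const y
    let e : ℕ → V1 := fun n => (t n)⁻¹ • (X n - v)
    have hte : ∀ n, t n • e n = X n - v := fun n => by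
      simp [e, smul_smul, (ht n).ne']
    have hπe : ∀ n, π (e n) = y := fun n => by
      simp [e, hX, hv, smul_smul, (ht n).ne']
    have hne1 : ∀ n, ∀ s ∈ Set.Icc (0 : ℝ) 1, v + s • t n • e n ≠ 0 := fun n s hs =>
      hπ0 _ (by simpa [hv, hπe] using hne2 n s hs)
    choose a ha ha' using fun n => aux_lagrange hF1 v (t n • e n) (hne1 n)
    choose b hb hb' using fun n => aux_lagrange hF2 w (t n • y) (hne2 n)
    have key : ∀ n, auxH F1 (v + a n • t n • e n) (e n) = auxH F2 (w + b n • t n • y) y := by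
      intro n
      have h1 := ha' n
      have h2 := hb' n
      have h3 := hcrit (t n • e n)
      rw [show v + t n • e n = X n by rw [hte]; abel, hX', h2, h3, heq, map_smul π, hπe,
        auxH_smul, auxH_smul] at h1
      apply mul_left_cancel₀ (pow_pos (ht n) 2).ne'
      linarith
    have hBt : Tendsto (fun n => auxH F2 (w + b n • t n • y) y) atTop (𝓝 (auxH F2 w y)) :=
      auxH_tendsto hF2 hw (aux_tend w hb hy0) tendsto_const_nhds
    -- boundedness of the lifts
    obtain ⟨β, hβ, hβ'⟩ := aux_lower hF1
    have hFt : Tendsto (fun n => F2 (w + t n • y)) atTop (𝓝 (F2 w)) := by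
      have := hy0.const_add w
      rw [add_zero] at this
      exact (hF2.continuous.tendsto w).comp this
    obtain ⟨M, hM⟩ := hFt.bddAbove_range
    obtain ⟨N, hN⟩ := hBt.bddAbove_range
    let R : ℝ := max ‖v‖ (M / β)
    have hXR : ∀ n, ‖X n‖ ≤ R := fun n => le_max_of_le_right (by
      rw [le_div_iff₀ hβ, mul_comm]
      exact (hβ' _).trans ((hX' n).le.trans (hM ⟨n, rfl⟩)))
    let K : Set V1 := Metric.closedBall 0 R ∩ {z | ‖π z - w‖ ≤ ‖w‖ / 2}
    have hπc : Continuous π := π.continuous_of_finiteDimensional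
    have hK : IsCompact K := (isCompact_closedBall 0 R).inter_right
      (isClosed_le (by fun_prop) continuous_const)
    have hK0 : ∀ z ∈ K, z ≠ 0 := by
      rintro z ⟨-, hz⟩ rfl
      have := norm_pos_iff.2 hw
      simp at hz
      linarith
    obtain ⟨α, hα, hα'⟩ := auxH_lower hF1 hK hK0
    have hzK : ∀ n, v + a n • t n • e n ∈ K := by
      intro n
      have hs := ha n
      constructor
      · have hc := convex_closedBall (0 : V1) R
        have := hc.add_smul_sub_mem (x := v) (y := X n) (by simp [R]) (by simpa using hXR n)
          ⟨hs.1.le, hs.2.le⟩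
        rwa [← hte] at this
      · have := aux_seg ⟨hs.1.le, hs.2.le⟩ (hty n)
        simpa [hv, hπe] using this
    have heb : ∀ n, e n ∈ Metric.closedBall (0 : V1) (Real.sqrt (N / α)) := fun n => by
      rw [mem_closedBall_zero_iff]
      apply Real.le_sqrt_of_sq_le
      rw [le_div_iff₀ hα, mul_comm]
      exact (hα' _ (hzK n) _).trans ((key n).le.trans (hN ⟨n, rfl⟩))
    obtain ⟨x, -, φ, hφ, hx⟩ := (isCompact_closedBall (0 : V1) _).tendsto_subseq heb
    refine ⟨x, ?_, ?_⟩
    · refine tendsto_nhds_unique ((hπc.tendsto x).comp hx) ?_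
      simp [Function.comp_def, hπe]
    · have hd : Tendsto (fun n => t (φ n) • e (φ n)) atTop (𝓝 0) := by
        simpa using (ht0.comp hφ.tendsto_atTop).smul hx
      refine tendsto_nhds_unique
        (auxH_tendsto hF1 hv0 (aux_tend v (fun n => ha (φ n)) hd) hx) ?_
      have := hBt.comp hφ.tendsto_atTop
      refine this.congr fun n => (key (φ n)).symm

end

/-- If pi : (V1,F1) -> (V2,F2) is an isometric submersion of Minkowski spaces, w is nonzero,
and v is the horizontal lift of w (so pi v = w and F1 v = inf {F1 x | pi x = w}),
then pi is an isometric submersion between the Euclidean spaces (V1, g_v) and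
(V2, g_w): it maps the ellipsoid {x | g_v(x,x) <= 1} onto the ellipsoid
{y | g_w(y,y) <= 1}. -/
theorem submersion_hessian_submersion
    {V1 V2 : Type*} [NormedAddCommGroup V1] [NormedSpace ℝ V1] [FiniteDimensional ℝ V1]
    [NormedAddCommGroup V2] [NormedSpace ℝ V2] [FiniteDimensional ℝ V2]
    (F1 : V1 → ℝ) (F2 : V2 → ℝ)
    (hF1 : IsMinkowskiNorm F1) (hF2 : IsMinkowskiNorm F2)
    (π : V1 →ₗ[ℝ] V2)
    (hsub : π '' {v | F1 v ≤ 1} = {w | F2 w ≤ 1})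
    (w : V2) (hw : w ≠ 0) (v : V1) (hv : π v = w)
    (hmin : F1 v = sInf (F1 '' {x | π x = w})) :
    π '' {x : V1 | (1 / 2 : ℝ) * iteratedFDeriv ℝ 2 (fun z => F1 z ^ 2) v ![x, x] ≤ 1}
      = {y : V2 | (1 / 2 : ℝ) * iteratedFDeriv ℝ 2 (fun z => F2 z ^ 2) w ![y, y] ≤ 1} := by
  have heq := aux_min hF1 hF2 π hsub w hw v hv hmin
  obtain ⟨h1, h2⟩ := aux_main hF1 hF2 π hsub w hw v hv heq
  have e1 : ∀ x : V1, iteratedFDeriv ℝ 2 (fun z => F1 z ^ 2) v ![x, x] = auxH F1 v x := fun x => by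
    rw [iteratedFDeriv_two_apply]; rfl
  have e2 : ∀ x : V2, iteratedFDeriv ℝ 2 (fun z => F2 z ^ 2) w ![x, x] = auxH F2 w x := fun x => by
    rw [iteratedFDeriv_two_apply]; rfl
  simp only [e1, e2]
  ext y
  constructor
  · rintro ⟨x, hx, rfl⟩
    have := h1 x
    simp only [Set.mem_ofPred_eq] at hx ⊢
    linarith
  · intro hy
    obtain ⟨x, hx, hxy⟩ := h2 y
    refine ⟨x, ?_, hx⟩
    simp only [Set.mem_ofPred_eq] at hy ⊢
    linarith
end
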